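/- arXiv:2503.00188 — 5 statements merged into one kernel-verified Lean document; each statement's English description precedes it below -/
import Mathlib

section
/- Let A be a (possibly noncommutative) star-algebra over ℂ. Fix N : ℕ, families a b : Fin N → A, α : Fin N → ℂ, strictly positive weights ω : Fin N → ℝ, and a real number δ ≠ 0. Define the local-oscillator amplitudes γ k = −i * α k / (ω k * δ), and outgoing modes c k = (1/√2) • (a k + b k + (γ k) • 1) and d k = (1/√2) • (a k − b k − (γ k) • 1). Then δ • Σ_k (ω k) • (star (c k) * c k − star (d k) * d k) = Σ_k ((−i * α k) • star (a k) + (i * conj (α k)) • a k) + δ • Σ_k (ω k) • (star (a k) * b k + star (b k) * a k). -/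
open scoped BigOperators

/-- The difference of the two output numbers of a balanced beam splitter is the
interference term of the two inputs. -/
theorem star_smul_mul_smul_sub {A : Type*} [Ring A] [StarRing A] [Algebra ℂ A] [StarModule ℂ A]
    (s : ℝ) (hs : s ^ 2 = 1 / 2) (x y : A) :
    star ((s : ℂ) • (x + y)) * ((s : ℂ) • (x + y)) -
      star ((s : ℂ) • (x - y)) * ((s : ℂ) • (x - y)) = star x * y + star y * x := by
  have hs' : (s : ℂ) * s * 2 = 1 := by
    rw [← sq, ← Complex.ofReal_pow, hs]
    norm_num
  have hstar : star (s : ℂ) = s := Complex.conj_ofReal s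
  have h : star (x + y) * (x + y) - star (x - y) * (x - y) =
      (2 : ℂ) • (star x * y + star y * x) := by
    rw [two_smul, star_add, star_sub]
    noncomm_ring
  simp only [star_smul, hstar, smul_mul_smul_comm]
  rw [← smul_sub, h, smul_smul, hs', one_smul]

/-- The algebraic identity defining the broadband pulsed (BBP) homodyne
measurement operator: each detector records the energy observable
`Σ_k ω_k f†_k f_k`, the local oscillator carries the displacement amplitudes
`γ_k = −i α_k/(ω_k δ)`, and `δ` times the difference of the two detectors'
energy observables equals the target generalized quadrature plus a `δ`
correction term. -/
theorem bbp_stmt1 {A : Type*} [Ring A] [StarRing A] [Algebra ℂ A] [StarModule ℂ A]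
    (N : ℕ) (a b c d : Fin N → A) (α : Fin N → ℂ) (ω : Fin N → ℝ)
    (hω : ∀ k, 0 < ω k) (δ : ℝ) (hδ : δ ≠ 0)
    (γ : Fin N → ℂ)
    (hγ : ∀ k, γ k = -Complex.I * α k / ((ω k : ℂ) * (δ : ℂ)))
    (hc : ∀ k, c k = (((1 / Real.sqrt 2 : ℝ) : ℂ)) •
      (a k + b k + (γ k) • (1 : A)))
    (hd : ∀ k, d k = (((1 / Real.sqrt 2 : ℝ) : ℂ)) •
      (a k - b k - (γ k) • (1 : A))) :
    (δ : ℂ) • ∑ k, (ω k : ℂ) • (star (c k) * c k - star (d k) * d k)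
      = ∑ k, ((-Complex.I * α k) • star (a k)
              + (Complex.I * starRingEnd ℂ (α k)) • a k)
        + (δ : ℂ) • ∑ k, (ω k : ℂ) • (star (a k) * b k + star (b k) * a k) := by
  rw [Finset.smul_sum, Finset.smul_sum, ← Finset.sum_add_distrib]
  refine Finset.sum_congr rfl fun k _ => ?_
  have hδ' : (δ : ℂ) ≠ 0 := Complex.ofReal_ne_zero.mpr hδ
  have hω' : (ω k : ℂ) ≠ 0 := Complex.ofReal_ne_zero.mpr (hω k).ne'
  have h₁ : -Complex.I * α k = (δ : ℂ) * ω k * γ k := by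
    rw [hγ]
    field_simp
  have h₂ : Complex.I * starRingEnd ℂ (α k) = (δ : ℂ) * ω k * star (γ k) := by
    simpa using congrArg (starRingEnd ℂ) h₁
  have hd' : d k = (((1 / Real.sqrt 2 : ℝ) : ℂ)) • (a k - (b k + γ k • (1 : A))) := by
    rw [hd, sub_sub]
  have hc' : c k = (((1 / Real.sqrt 2 : ℝ) : ℂ)) • (a k + (b k + γ k • (1 : A))) := by
    rw [hc, add_assoc]
  rw [hc', hd', star_smul_mul_smul_sub _ (by rw [div_pow, Real.sq_sqrt zero_le_two, one_pow]),
    h₁, h₂]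
  simp only [star_add, star_smul, star_one, mul_add, add_mul, mul_smul_comm, smul_mul_assoc,
    mul_one, one_mul, smul_add, mul_smul]
  abel
end

section
/- In the BBP homodyne operator setting (see context), for every n : ℕ there exist complex coefficients c_2, …, c_n such that for all real δ, ⟪v, (q + δ • C)^[n] v⟫ = ⟪v, q^[n] v⟫ + Σ_{k=2}^{n} c_k * δ^k, where ^[n] denotes the n-fold composition of a linear map. In particular, ⟪v, (q + δ • C)^[n] v⟫ − ⟪v, q^[n] v⟫ = O(δ²) as δ → 0. -/
open scoped BigOperators Asymptotics Topology ComplexConjugate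

local notation "⟪" x ", " y "⟫" => @inner ℂ _ _ x y

/-- The orbit of `v` under the pencil `q + δ • C` is polynomial in `δ`, and its linear coefficient lies
in every `q`-invariant submodule containing all the vectors `C (q^[m] v)`. -/
theorem exists_iterate_add_smul_eq_sum {R V : Type*} [CommSemiring R] [AddCommMonoid V] [Module R V]
    (q C : V →ₗ[R] V) (v : V) (S : Submodule R V) (hqS : ∀ x ∈ S, q x ∈ S)
    (hCS : ∀ m : ℕ, C ((⇑q)^[m] v) ∈ S) (n : ℕ) :
    ∃ w : ℕ → V, w 0 = (⇑q)^[n] v ∧ w 1 ∈ S ∧ (∀ k, n < k → w k = 0) ∧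
      ∀ δ : R, (⇑(q + δ • C))^[n] v = ∑ k ∈ Finset.range (n + 1), δ ^ k • w k := by
  induction n with
  | zero =>
    refine ⟨fun k => if k = 0 then v else 0, by simp, by simp, ?_, by simp⟩
    intro k hk
    simp [hk.ne']
  | succ n ih =>
    obtain ⟨w, h0, h1, hw, h⟩ := ih
    refine ⟨fun k => Nat.casesOn k (q (w 0)) fun j => q (w (j + 1)) + C (w j), ?_, ?_, ?_, ?_⟩
    · simp [h0, Function.iterate_succ_apply']
    · simpa [h0] using S.add_mem (hqS _ h1) (hCS n)
    · rintro (_ | j) hk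
      · omega
      · simp [hw j (by omega), hw (j + 1) (by omega)]
    · intro δ
      have hq_sum : q (∑ k ∈ Finset.range (n + 1), δ ^ k • w k)
          = ∑ k ∈ Finset.range (n + 1), δ ^ (k + 1) • q (w (k + 1)) + q (w 0) := by
        have hlast : δ ^ (n + 1) • w (n + 1) = 0 := by rw [hw _ n.lt_succ_self, smul_zero]
        rw [← add_zero (∑ k ∈ Finset.range (n + 1), δ ^ k • w k), ← hlast,
          ← Finset.sum_range_succ, Finset.sum_range_succ']
        simp
      rw [Function.iterate_succ_apply', h, LinearMap.add_apply, hq_sum,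
        Finset.sum_range_succ' _ (n + 1)]
      simp only [LinearMap.smul_apply, map_sum, map_smul, smul_smul, smul_add,
        Finset.sum_add_distrib, pow_zero, one_smul, pow_succ]
      exact add_right_comm _ _ _

/-- A finite sum of multiples of powers of order at least two is `O(δ²)` at the origin. -/
theorem isBigO_sum_Icc_two_mul_pow (c : ℕ → ℂ) (n : ℕ) :
    (fun δ : ℝ => ∑ k ∈ Finset.Icc 2 n, c k * (δ : ℂ) ^ k) =O[𝓝 (0 : ℝ)] fun δ : ℝ => δ ^ 2 := by
  refine Asymptotics.IsBigO.fun_sum fun k hk => ?_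
  obtain ⟨j, rfl⟩ := Nat.exists_eq_add_of_le (Finset.mem_Icc.mp hk).1
  have hcont : Continuous fun δ : ℝ => c (2 + j) * (δ : ℂ) ^ j := by fun_prop
  have hsq : (fun δ : ℝ => (δ : ℂ) ^ 2) =O[𝓝 (0 : ℝ)] fun δ : ℝ => δ ^ 2 :=
    Asymptotics.isBigO_of_le _ fun δ => by simp
  have hprod := (hcont.continuousAt (x := 0)).isBigO_one ℝ |>.mul hsq
  simpa only [one_mul, mul_assoc, ← pow_add, add_comm j 2] using hprod

/-- Operator form of Theorem 1 of the paper, in the BBP homodyne operator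
setting: the `n`-th moment of the BBP homodyne measurement operator
`q_δ = q + δ • C` differs from the `n`-th moment of the target quadrature `q`
by a polynomial `Σ_{k=2}^{n} c_k δ^k` in `δ` with no constant or linear term;
in particular the difference is `O(δ²)` as `δ → 0`. -/
theorem bbp_stmt5 {V : Type*} [NormedAddCommGroup V] [InnerProductSpace ℂ V]
    (N : ℕ) (a adjA b adjB : Fin N → V →ₗ[ℂ] V)
    (hadjA : ∀ k, ∀ x y : V, ⟪adjA k x, y⟫ = ⟪x, a k y⟫)
    (hadjB : ∀ k, ∀ x y : V, ⟪adjB k x, y⟫ = ⟪x, b k y⟫)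
    (hba : ∀ k l, b k ∘ₗ a l = a l ∘ₗ b k)
    (hbadjA : ∀ k l, b k ∘ₗ adjA l = adjA l ∘ₗ b k)
    (hadjBa : ∀ k l, adjB k ∘ₗ a l = a l ∘ₗ adjB k)
    (hadjBadjA : ∀ k l, adjB k ∘ₗ adjA l = adjA l ∘ₗ adjB k)
    (v : V) (hv : ∀ k, b k v = 0)
    (α : Fin N → ℂ) (ω : Fin N → ℝ)
    (q C : V →ₗ[ℂ] V)
    (hq : q = ∑ k, ((-Complex.I * α k) • adjA k + (Complex.I * conj (α k)) • a k))
    (hC : C = ∑ k, (ω k : ℂ) • (adjA k ∘ₗ b k + adjB k ∘ₗ a k))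
    (n : ℕ) :
    (∃ c : ℕ → ℂ,
        ∀ δ : ℝ, ⟪v, (⇑(q + (δ : ℂ) • C))^[n] v⟫
          = ⟪v, (⇑q)^[n] v⟫ + ∑ k ∈ Finset.Icc 2 n, c k * (δ : ℂ) ^ k)
      ∧ (fun δ : ℝ => ⟪v, (⇑(q + (δ : ℂ) • C))^[n] v⟫ - ⟪v, (⇑q)^[n] v⟫)
          =O[𝓝 (0 : ℝ)] fun δ : ℝ => δ ^ 2 := by
  have hbq : ∀ k, Function.Commute (b k) q := by
    intro k x
    have h₁ := fun l => LinearMap.congr_fun (hba k l)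
    have h₂ := fun l => LinearMap.congr_fun (hbadjA k l)
    simp only [LinearMap.comp_apply] at h₁ h₂
    simp [hq, LinearMap.sum_apply, h₁, h₂]
  have hadjBq : ∀ k, Function.Commute (adjB k) q := by
    intro k x
    have h₁ := fun l => LinearMap.congr_fun (hadjBa k l)
    have h₂ := fun l => LinearMap.congr_fun (hadjBadjA k l)
    simp only [LinearMap.comp_apply] at h₁ h₂
    simp [hq, LinearMap.sum_apply, h₁, h₂]
  have hvadjB : ∀ k x, ⟪v, adjB k x⟫ = 0 := by
    intro k x
    rw [← inner_conj_symm, hadjB, hv, inner_zero_right, map_zero]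
  let S : Submodule ℂ V := ⨅ j : ℕ, LinearMap.ker ((innerₛₗ ℂ v) ∘ₗ q ^ j)
  have hS : ∀ x, x ∈ S ↔ ∀ j : ℕ, ⟪v, (⇑q)^[j] x⟫ = 0 := by
    intro x
    simp [S, Submodule.mem_iInf, Module.End.pow_apply]
  have hqS : ∀ x ∈ S, q x ∈ S := by
    intro x hx
    rw [hS] at hx ⊢
    exact fun j => hx (j + 1)
  have hCS : ∀ m : ℕ, C ((⇑q)^[m] v) ∈ S := by
    intro m
    have hb : ∀ k, b k ((⇑q)^[m] v) = 0 := fun k => by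
      rw [((hbq k).iterate_right m).eq, hv, iterate_map_zero]
    simp only [hC, LinearMap.sum_apply, LinearMap.smul_apply, LinearMap.add_apply,
      LinearMap.comp_apply, hb, map_zero, zero_add]
    refine S.sum_mem fun k _ => S.smul_mem _ ((hS _).2 fun j => ?_)
    rw [← ((hadjBq k).iterate_right j).eq, hvadjB]
  obtain ⟨w, h0, h1, -, h⟩ := exists_iterate_add_smul_eq_sum q C v S hqS hCS n
  have hw1 : ⟪v, w 1⟫ = 0 := (hS _).1 h1 0
  have hexp : ∀ δ : ℝ, ⟪v, (⇑(q + (δ : ℂ) • C))^[n] v⟫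
      = ⟪v, (⇑q)^[n] v⟫ + ∑ k ∈ Finset.Icc 2 n, ⟪v, w k⟫ * (δ : ℂ) ^ k := by
    intro δ
    rw [h, Finset.range_eq_Ico, Finset.sum_eq_sum_Ico_succ_bot n.succ_pos, pow_zero, one_smul, h0,
      inner_add_right, inner_sum]
    congr 1
    simp only [inner_smul_right, mul_comm]
    symm
    apply Finset.sum_subset
    · intro k
      simp only [Finset.mem_Icc, Finset.mem_Ico]
      omega
    · intro k hk hk'
      simp only [Finset.mem_Icc, Finset.mem_Ico] at hk hk'
      obtain rfl : k = 1 := by omega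
      rw [hw1, mul_zero]
  refine ⟨⟨_, hexp⟩, ?_⟩
  simp only [hexp, add_sub_cancel_left]
  exact isBigO_sum_Icc_two_mul_pow _ n
end

section
/- In the BBP homodyne operator setting (see context), for all natural numbers j and m, ⟪v, q^[j] (C (q^[m] v))⟫ = 0, where ^[j] denotes the j-fold composition of a linear map. -/
open scoped BigOperators ComplexConjugate

local notation "⟪" x ", " y "⟫" => @inner ℂ _ _ x y

/-- Key vanishing lemma in the proof of Theorem 1 of the paper, in the BBP
homodyne operator setting: the expectation of every monomial containing
exactly one factor of the correction operator `C` vanishes, because `C` is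
linear in the local-oscillator mode operators and the local-oscillator modes
are in vacuum. -/
theorem bbp_stmt6 {V : Type*} [NormedAddCommGroup V] [InnerProductSpace ℂ V]
    (N : ℕ) (a adjA b adjB : Fin N → V →ₗ[ℂ] V)
    (hadjA : ∀ k, ∀ x y : V, ⟪adjA k x, y⟫ = ⟪x, a k y⟫)
    (hadjB : ∀ k, ∀ x y : V, ⟪adjB k x, y⟫ = ⟪x, b k y⟫)
    (hba : ∀ k l, b k ∘ₗ a l = a l ∘ₗ b k)
    (hbadjA : ∀ k l, b k ∘ₗ adjA l = adjA l ∘ₗ b k)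
    (hadjBa : ∀ k l, adjB k ∘ₗ a l = a l ∘ₗ adjB k)
    (hadjBadjA : ∀ k l, adjB k ∘ₗ adjA l = adjA l ∘ₗ adjB k)
    (v : V) (hv : ∀ k, b k v = 0)
    (α : Fin N → ℂ) (ω : Fin N → ℝ)
    (q C : V →ₗ[ℂ] V)
    (hq : q = ∑ k, ((-Complex.I * α k) • adjA k + (Complex.I * conj (α k)) • a k))
    (hC : C = ∑ k, (ω k : ℂ) • (adjA k ∘ₗ b k + adjB k ∘ₗ a k))
    (j m : ℕ) :
    ⟪v, (⇑q)^[j] (C ((⇑q)^[m] v))⟫ = 0 := by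
  have hbq : ∀ k, Function.Commute (b k) q := fun k x => by
    have h₁ l := LinearMap.congr_fun (hba k l) x
    have h₂ l := LinearMap.congr_fun (hbadjA k l) x
    simp only [LinearMap.comp_apply] at h₁ h₂
    simp [hq, LinearMap.sum_apply, h₁, h₂]
  have hadjBq : ∀ k, Function.Commute (adjB k) q := fun k x => by
    have h₁ l := LinearMap.congr_fun (hadjBa k l) x
    have h₂ l := LinearMap.congr_fun (hadjBadjA k l) x
    simp only [LinearMap.comp_apply] at h₁ h₂
    simp [hq, LinearMap.sum_apply, h₁, h₂]
  have hbv : ∀ k, b k ((⇑q)^[m] v) = 0 := fun k => by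
    rw [(hbq k).iterate_right m v, hv, ← Module.End.pow_apply, map_zero]
  have hinner : ∀ k x, ⟪v, adjB k x⟫ = 0 := fun k x => by
    rw [← inner_conj_symm, hadjB, hv, inner_zero_right, map_zero]
  have hpow : ∀ k x, (q ^ j) (adjB k x) = adjB k ((q ^ j) x) := fun k x => by
    simpa only [Module.End.pow_apply] using ((hadjBq k).iterate_right j x).symm
  rw [← Module.End.pow_apply q j, hC]
  simp [LinearMap.sum_apply, hbv, hpow, hinner]
end

section
/- In the BBP homodyne operator setting (see context), ⟪v, C v⟫ = 0; consequently, for every real δ, ⟪v, (q + δ • C) v⟫ = ⟪v, q v⟫. -/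
open scoped BigOperators ComplexConjugate

local notation "⟪" x ", " y "⟫" => @inner ℂ _ _ x y

/-- In the BBP homodyne operator setting, `⟪v, C v⟫ = 0`; consequently the
first moment of the BBP homodyne outcome equals the first moment of the target
quadrature, for every real local-oscillator parameter `δ`. -/
theorem bbp_stmt7 {V : Type*} [NormedAddCommGroup V] [InnerProductSpace ℂ V]
    (N : ℕ) (a adjA b adjB : Fin N → V →ₗ[ℂ] V)
    (hadjA : ∀ k, ∀ x y : V, ⟪adjA k x, y⟫ = ⟪x, a k y⟫)
    (hadjB : ∀ k, ∀ x y : V, ⟪adjB k x, y⟫ = ⟪x, b k y⟫)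
    (hba : ∀ k l, b k ∘ₗ a l = a l ∘ₗ b k)
    (hbadjA : ∀ k l, b k ∘ₗ adjA l = adjA l ∘ₗ b k)
    (hadjBa : ∀ k l, adjB k ∘ₗ a l = a l ∘ₗ adjB k)
    (hadjBadjA : ∀ k l, adjB k ∘ₗ adjA l = adjA l ∘ₗ adjB k)
    (v : V) (hv : ∀ k, b k v = 0)
    (α : Fin N → ℂ) (ω : Fin N → ℝ)
    (q C : V →ₗ[ℂ] V)
    (hq : q = ∑ k, ((-Complex.I * α k) • adjA k + (Complex.I * conj (α k)) • a k))
    (hC : C = ∑ k, (ω k : ℂ) • (adjA k ∘ₗ b k + adjB k ∘ₗ a k)) :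
    ⟪v, C v⟫ = 0 ∧ ∀ δ : ℝ, ⟪v, (q + (δ : ℂ) • C) v⟫ = ⟪v, q v⟫ := by
  have hCv : ⟪v, C v⟫ = 0 := by
    rw [hC, LinearMap.sum_apply, inner_sum]
    refine Finset.sum_eq_zero fun k _ => ?_
    have hB : ⟪v, adjB k (a k v)⟫ = 0 := by
      rw [← inner_conj_symm, hadjB, hv, inner_zero_right, map_zero]
    rw [LinearMap.smul_apply, LinearMap.add_apply, LinearMap.comp_apply, LinearMap.comp_apply,
      hv, map_zero, zero_add, inner_smul_right, hB, mul_zero]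
  refine ⟨hCv, fun δ => ?_⟩
  rw [LinearMap.add_apply, LinearMap.smul_apply, inner_add_right, inner_smul_right, hCv,
    mul_zero, add_zero]
end

section
/- In the BBP homodyne operator setting (see context), assume in addition the commutation relations b_k ∘ b†_l − b†_l ∘ b_k = (if k = l then id else 0) for all k l : Fin N. Then for every real δ, ⟪v, (q + δ • C) ((q + δ • C) v)⟫ − ⟪v, q (q v)⟫ = δ² * Σ_k (ω k)² * ‖a_k v‖². -/
open scoped BigOperators ComplexConjugate

local notation "⟪" x ", " y "⟫" => @inner ℂ _ _ x y

/-- The paper's explicit second-moment computation in the BBP homodyne operator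
setting (with the additional canonical commutation relations
`[b_k, b†_l] = δ_{kl} id` for the local-oscillator modes): the second moment of
the BBP homodyne outcome is biased high relative to that of the target
quadrature by exactly `δ² Σ_k ω_k² ‖a_k v‖²`. -/
theorem bbp_stmt8 {V : Type*} [NormedAddCommGroup V] [InnerProductSpace ℂ V]
    (N : ℕ) (a adjA b adjB : Fin N → V →ₗ[ℂ] V)
    (hadjA : ∀ k, ∀ x y : V, ⟪adjA k x, y⟫ = ⟪x, a k y⟫)
    (hadjB : ∀ k, ∀ x y : V, ⟪adjB k x, y⟫ = ⟪x, b k y⟫)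
    (hba : ∀ k l, b k ∘ₗ a l = a l ∘ₗ b k)
    (hbadjA : ∀ k l, b k ∘ₗ adjA l = adjA l ∘ₗ b k)
    (hadjBa : ∀ k l, adjB k ∘ₗ a l = a l ∘ₗ adjB k)
    (hadjBadjA : ∀ k l, adjB k ∘ₗ adjA l = adjA l ∘ₗ adjB k)
    (hccr : ∀ k l, b k ∘ₗ adjB l - adjB l ∘ₗ b k
      = if k = l then (LinearMap.id : V →ₗ[ℂ] V) else 0)
    (v : V) (hv : ∀ k, b k v = 0)
    (α : Fin N → ℂ) (ω : Fin N → ℝ)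
    (q C : V →ₗ[ℂ] V)
    (hq : q = ∑ k, ((-Complex.I * α k) • adjA k + (Complex.I * conj (α k)) • a k))
    (hC : C = ∑ k, (ω k : ℂ) • (adjA k ∘ₗ b k + adjB k ∘ₗ a k)) :
    ∀ δ : ℝ,
      ⟪v, (q + (δ : ℂ) • C) ((q + (δ : ℂ) • C) v)⟫ - ⟪v, q (q v)⟫
        = ((δ : ℂ)) ^ 2 * ∑ k, ((ω k : ℂ)) ^ 2 * ((‖a k v‖ : ℂ)) ^ 2 := by
  subst hC
  have inner_adjA : ∀ k, ∀ x y : V, ⟪x, adjA k y⟫ = ⟪a k x, y⟫ := fun k x y => by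
    rw [← inner_conj_symm, hadjA, inner_conj_symm]
  have inner_adjB : ∀ k, ∀ x y : V, ⟪x, adjB k y⟫ = ⟪b k x, y⟫ := fun k x y => by
    rw [← inner_conj_symm, hadjB, inner_conj_symm]
  have b_a : ∀ k l x, b k (a l x) = a l (b k x) := fun k l x =>
    LinearMap.congr_fun (hba k l) x
  have b_q : ∀ k x, b k (q x) = q (b k x) := fun k x => by
    have h : ∀ l, b k (adjA l x) = adjA l (b k x) := fun l =>
      LinearMap.congr_fun (hbadjA k l) x
    simp [hq, LinearMap.sum_apply, map_sum, h, b_a]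
  have adjB_q : ∀ k x, adjB k (q x) = q (adjB k x) := fun k x => by
    have h : ∀ l, adjB k (adjA l x) = adjA l (adjB k x) := fun l =>
      LinearMap.congr_fun (hadjBadjA k l) x
    have h' : ∀ l, adjB k (a l x) = a l (adjB k x) := fun l =>
      LinearMap.congr_fun (hadjBa k l) x
    simp [hq, LinearMap.sum_apply, map_sum, h, h']
  have b_adjB : ∀ k l x, b k (adjB l x) = adjB l (b k x) + if k = l then x else 0 :=
    fun k l x => by
      have h := LinearMap.congr_fun (hccr k l) x
      rw [LinearMap.sub_apply, sub_eq_iff_eq_add'] at h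
      simp only [LinearMap.comp_apply] at h
      rw [h]
      split_ifs <;> simp
  set C : V →ₗ[ℂ] V := ∑ k, (ω k : ℂ) • (adjA k ∘ₗ b k + adjB k ∘ₗ a k) with hC
  have inner_C : ∀ y, ⟪v, C y⟫ = ∑ k, (ω k : ℂ) * ⟪a k v, b k y⟫ := fun y => by
    simp [hC, LinearMap.sum_apply, inner_adjA, inner_adjB, hv]
  have C_v : C v = ∑ k, (ω k : ℂ) • adjB k (a k v) := by
    simp [hC, LinearMap.sum_apply, hv]
  have hCq : ⟪v, C (q v)⟫ = 0 := by
    simp [inner_C, b_q, hv]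
  have hqC : ⟪v, q (C v)⟫ = 0 := by
    simp [C_v, map_sum, ← adjB_q, inner_adjB, hv]
  have hCC : ⟪v, C (C v)⟫ = ∑ k, (ω k : ℂ) ^ 2 * (‖a k v‖ : ℂ) ^ 2 := by
    rw [inner_C]
    refine Finset.sum_congr rfl fun k _ => ?_
    have h : b k (C v) = (ω k : ℂ) • a k v := by
      simp [C_v, map_sum, b_adjB, b_a, hv]
    rw [h, inner_smul_right, inner_self_eq_norm_sq_to_K]
    simp only [Complex.coe_algebraMap]
    ring
  intro δ
  simp only [LinearMap.add_apply, LinearMap.smul_apply, map_add, map_smul,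
    inner_add_right, inner_smul_right, smul_add, hCq, hqC, hCC]
  ring
end
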